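/- Let G be the context-free grammar with nonterminals {S, X, X̄, Y, Ȳ, A, B, C, D}, terminals {0, 1, #}, start symbol S, and rules: S → X#X̄; X → 1AX, X → 0BX, X → 1CY, X → 1C; X̄ → 1X̄A, X̄ → 0X̄B, X̄ → 0ȲC, X̄ → 0C; and for each α ∈ {0,1}: Y → αDY, Y → αD, Ȳ → αȲD, Ȳ → αD. Set W = {A, B, C, D, #} and F = {w#w^R : w ∈ {A,B,C,D}⁺}. Then L(G,F) = {u#v : u, v ∈ {0,1}⁺, |u| = |v|, and the integer represented by u in binary is strictly greater than the integer represented by v in binary}. -/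

import Mathlib

/- The weak identity from `V*` to `W*`: keeps symbols of `W`, erases all others. -/
open scoped Classical in
noncomputable def projOn {α : Type*} (W : Set α) (y : List α) : List α :=
  y.filter (fun a => decide (a ∈ W))

/-- Erase all nonterminals, keeping the terminal string. -/
def projT {T N : Type*} (y : List (Symbol T N)) : List T :=
  y.filterMap (fun s => match s with
    | Symbol.terminal t => some t
    | Symbol.nonterminal _ => none)

/-- The language of a context-free grammar `G` finalized by a final language `F`
over the subalphabet `W` of the total alphabet of `G`:  `L(G,F)` consists of the
terminal strings obtained from sentential forms `y` of `G` such that the projection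
of `y` onto `W` belongs to `F` and every symbol of `y` lies in `W ∪ T`. -/
noncomputable def finalizedLanguage {T : Type*} (G : ContextFreeGrammar T)
    (W : Set (Symbol T G.NT)) (F : Language (Symbol T G.NT)) : Language T :=
  { x | ∃ y : List (Symbol T G.NT),
      G.Derives [Symbol.nonterminal G.initial] y ∧
      projOn W y ∈ F ∧
      (∀ s ∈ y, s ∈ W ∨ ∃ t, s = Symbol.terminal t) ∧
      x = projT y }

/-- Nonterminals `{S, X, X̄, Y, Ȳ, A, B, C, D}` of the grammar of STATEMENT 13
(`Xb`, `Yb` stand for `X̄`, `Ȳ`). -/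
inductive NT13 : Type
  | S | X | Xb | Y | Yb | A | B | C | D
deriving DecidableEq

/-- The integer represented by a binary string in the standard way,
e.g. `i(011) = 3`. -/
def binVal (u : List (Fin 2)) : ℕ :=
  u.foldl (fun n b => 2 * n + b.val) 0

/- The grammar `G` of STATEMENT 13, with terminals `{0, 1, #}` modelled as `Fin 3`
(with `2` playing the role of `#`) and rules: `S → X#X̄`; `X → 1AX`, `X → 0BX`,
`X → 1CY`, `X → 1C`; `X̄ → 1X̄A`, `X̄ → 0X̄B`, `X̄ → 0ȲC`, `X̄ → 0C`; and for each
`α ∈ {0,1}`: `Y → αDY`, `Y → αD`, `Ȳ → αȲD`, `Ȳ → αD`. -/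
open scoped Classical in
noncomputable def grammarG13 : ContextFreeGrammar (Fin 3) :=
  ⟨NT13, NT13.S,
    {⟨NT13.S, [Symbol.nonterminal NT13.X, Symbol.terminal 2, Symbol.nonterminal NT13.Xb]⟩,
     ⟨NT13.X, [Symbol.terminal 1, Symbol.nonterminal NT13.A, Symbol.nonterminal NT13.X]⟩,
     ⟨NT13.X, [Symbol.terminal 0, Symbol.nonterminal NT13.B, Symbol.nonterminal NT13.X]⟩,
     ⟨NT13.X, [Symbol.terminal 1, Symbol.nonterminal NT13.C, Symbol.nonterminal NT13.Y]⟩,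
     ⟨NT13.X, [Symbol.terminal 1, Symbol.nonterminal NT13.C]⟩,
     ⟨NT13.Xb, [Symbol.terminal 1, Symbol.nonterminal NT13.Xb, Symbol.nonterminal NT13.A]⟩,
     ⟨NT13.Xb, [Symbol.terminal 0, Symbol.nonterminal NT13.Xb, Symbol.nonterminal NT13.B]⟩,
     ⟨NT13.Xb, [Symbol.terminal 0, Symbol.nonterminal NT13.Yb, Symbol.nonterminal NT13.C]⟩,
     ⟨NT13.Xb, [Symbol.terminal 0, Symbol.nonterminal NT13.C]⟩,
     ⟨NT13.Y, [Symbol.terminal 0, Symbol.nonterminal NT13.D, Symbol.nonterminal NT13.Y]⟩,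
     ⟨NT13.Y, [Symbol.terminal 1, Symbol.nonterminal NT13.D, Symbol.nonterminal NT13.Y]⟩,
     ⟨NT13.Y, [Symbol.terminal 0, Symbol.nonterminal NT13.D]⟩,
     ⟨NT13.Y, [Symbol.terminal 1, Symbol.nonterminal NT13.D]⟩,
     ⟨NT13.Yb, [Symbol.terminal 0, Symbol.nonterminal NT13.Yb, Symbol.nonterminal NT13.D]⟩,
     ⟨NT13.Yb, [Symbol.terminal 1, Symbol.nonterminal NT13.Yb, Symbol.nonterminal NT13.D]⟩,
     ⟨NT13.Yb, [Symbol.terminal 0, Symbol.nonterminal NT13.D]⟩,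
     ⟨NT13.Yb, [Symbol.terminal 1, Symbol.nonterminal NT13.D]⟩}⟩

namespace ContextFreeGrammar

/-- The language of words over the symbols of a grammar obtained by interpreting every terminal
as itself and every nonterminal `n` as `L n`. -/
def symbolLanguage {T N : Type*} (L : N → Language (Symbol T N)) :
    Symbol T N → Language (Symbol T N)
  | Symbol.terminal t => {[Symbol.terminal t]}
  | Symbol.nonterminal n => L n

/-- If an interpretation of the nonterminals is closed under the rules, then rewriting shrinks
the interpretation of a word. -/
theorem Derives.prod_symbolLanguage_le {T : Type*} {g : ContextFreeGrammar T}
    {L : g.NT → Language (Symbol T g.NT)}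
    (hL : ∀ r ∈ g.rules, (r.output.map (symbolLanguage L)).prod ≤ L r.input)
    {u v : List (Symbol T g.NT)} (h : g.Derives u v) :
    (v.map (symbolLanguage L)).prod ≤ (u.map (symbolLanguage L)).prod := by
  induction h with
  | refl => exact le_rfl
  | tail _ h ih =>
    refine le_trans ?_ ih
    obtain ⟨r, hr, hrw⟩ := h
    obtain ⟨p, q, rfl, rfl⟩ := hrw.exists_parts
    simp only [List.map_append, List.prod_append, List.map_singleton, List.prod_singleton]
    exact mul_le_mul' (mul_le_mul' le_rfl (hL r hr)) le_rfl

theorem mem_prod_symbolLanguage_self {T N : Type*} {L : N → Language (Symbol T N)}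
    {y : List (Symbol T N)} (h : ∀ n, Symbol.nonterminal n ∈ y → [Symbol.nonterminal n] ∈ L n) :
    y ∈ (y.map (symbolLanguage L)).prod := by
  induction y with
  | nil => exact Language.nil_mem_one
  | cons s y ih =>
    rw [List.map_cons, List.prod_cons]
    refine Language.append_mem_mul (a := [s]) ?_
      (ih fun n hn => h n (List.mem_cons_of_mem _ hn))
    cases s with
    | terminal t => exact Set.mem_singleton _
    | nonterminal n => exact h n List.mem_cons_self

theorem derives_of_mem_rules {T : Type*} {g : ContextFreeGrammar T} {n : g.NT}
    {w : List (Symbol T g.NT)} (h : ⟨n, w⟩ ∈ g.rules) : g.Derives [Symbol.nonterminal n] w :=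
  Produces.single ⟨_, h, ContextFreeRule.Rewrites.input_output⟩

end ContextFreeGrammar

namespace GrammarG13

open ContextFreeGrammar

/-- A bit as a terminal symbol. -/
def bit (b : Fin 2) : Symbol (Fin 3) NT13 := Symbol.terminal b.castSucc

/-- The nonterminal recording a bit of the common prefix: `A` for `1` and `B` for `0`. -/
def mark (b : Fin 2) : Symbol (Fin 3) NT13 :=
  Symbol.nonterminal (if b = 1 then NT13.A else NT13.B)

/-- The final words derivable from `Y`. -/
def leftTail (q : List (Fin 2)) : List (Symbol (Fin 3) NT13) :=
  q.flatMap fun b => [bit b, Symbol.nonterminal NT13.D]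

/-- The final words derivable from `X`. -/
def leftForm (p q : List (Fin 2)) : List (Symbol (Fin 3) NT13) :=
  (p.flatMap fun b => [bit b, mark b]) ++ bit 1 :: Symbol.nonterminal NT13.C :: leftTail q

/-- The final words derivable from `Ȳ`. -/
def rightTail (q : List (Fin 2)) : List (Symbol (Fin 3) NT13) :=
  q.map bit ++ List.replicate q.length (Symbol.nonterminal NT13.D)

/-- The final words derivable from `X̄`. -/
def rightForm (p q : List (Fin 2)) : List (Symbol (Fin 3) NT13) :=
  p.map bit ++ bit 0 :: (rightTail q ++ Symbol.nonterminal NT13.C :: (p.map mark).reverse)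

theorem leftTail_cons (b : Fin 2) (q : List (Fin 2)) :
    leftTail (b :: q) = bit b :: Symbol.nonterminal NT13.D :: leftTail q := rfl

theorem leftForm_cons (b : Fin 2) (p q : List (Fin 2)) :
    leftForm (b :: p) q = bit b :: mark b :: leftForm p q := rfl

theorem rightTail_cons (b : Fin 2) (q : List (Fin 2)) :
    rightTail (b :: q) = bit b :: (rightTail q ++ [Symbol.nonterminal NT13.D]) := by
  simp [rightTail, List.replicate_succ']

theorem rightForm_cons (b : Fin 2) (p q : List (Fin 2)) :
    rightForm (b :: p) q = bit b :: (rightForm p q ++ [mark b]) := by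
  simp [rightForm]

/-- The words without the nonterminals `S, X, X̄, Y, Ȳ` derivable from each nonterminal. -/
def finalWords : NT13 → Language (Symbol (Fin 3) NT13)
  | NT13.S => {y | ∃ p q p' q', y = leftForm p q ++ Symbol.terminal 2 :: rightForm p' q'}
  | NT13.X => {y | ∃ p q, y = leftForm p q}
  | NT13.Xb => {y | ∃ p q, y = rightForm p q}
  | NT13.Y => {y | ∃ q, y = leftTail q}
  | NT13.Yb => {y | ∃ q, y = rightTail q}
  | NT13.A => {[Symbol.nonterminal NT13.A]}
  | NT13.B => {[Symbol.nonterminal NT13.B]}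
  | NT13.C => {[Symbol.nonterminal NT13.C]}
  | NT13.D => {[Symbol.nonterminal NT13.D]}

theorem mem_singleton_mul {α : Type*} {a x : List α} {l : Language α} :
    x ∈ ({a} : Language α) * l ↔ ∃ b ∈ l, a ++ b = x := by
  rw [Language.mem_mul]
  exact ⟨fun ⟨_, rfl, h⟩ => h, fun h => ⟨a, rfl, h⟩⟩

/-- The rules of `grammarG13`, over the concrete symbol type. -/
noncomputable def rules : Finset (ContextFreeRule (Fin 3) NT13) := grammarG13.rules

theorem prod_symbolLanguage_finalWords_le :
    ∀ r ∈ grammarG13.rules,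
      (r.output.map (symbolLanguage finalWords)).prod ≤ finalWords r.input := by
  change ∀ r ∈ rules, _
  intro r hr x hx
  simp only [rules, grammarG13, Finset.mem_insert, Finset.mem_singleton] at hr
  rcases hr with rfl | rfl | rfl | rfl | rfl | rfl | rfl | rfl | rfl | rfl | rfl | rfl | rfl |
    rfl | rfl | rfl | rfl <;>
  simp only [List.map_cons, List.map_nil, List.prod_cons, List.prod_nil, mul_one,
    symbolLanguage] at hx
  · obtain ⟨_, ⟨p, q, rfl⟩, _, hy, rfl⟩ := Language.mem_mul.1 hx
    obtain ⟨_, ⟨p', q', rfl⟩, rfl⟩ := mem_singleton_mul.1 hy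
    exact ⟨p, q, p', q', rfl⟩
  · obtain ⟨_, hy, rfl⟩ := mem_singleton_mul.1 hx
    obtain ⟨_, ⟨p, q, rfl⟩, rfl⟩ := mem_singleton_mul.1 hy
    exact ⟨1 :: p, q, rfl⟩
  · obtain ⟨_, hy, rfl⟩ := mem_singleton_mul.1 hx
    obtain ⟨_, ⟨p, q, rfl⟩, rfl⟩ := mem_singleton_mul.1 hy
    exact ⟨0 :: p, q, rfl⟩
  · obtain ⟨_, hy, rfl⟩ := mem_singleton_mul.1 hx
    obtain ⟨_, ⟨q, rfl⟩, rfl⟩ := mem_singleton_mul.1 hy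
    exact ⟨[], q, rfl⟩
  · obtain ⟨_, rfl, rfl⟩ := mem_singleton_mul.1 hx
    exact ⟨[], [], rfl⟩
  · obtain ⟨_, hy, rfl⟩ := mem_singleton_mul.1 hx
    obtain ⟨_, ⟨p, q, rfl⟩, _, rfl, rfl⟩ := Language.mem_mul.1 hy
    exact ⟨1 :: p, q, (rightForm_cons 1 p q).symm⟩
  · obtain ⟨_, hy, rfl⟩ := mem_singleton_mul.1 hx
    obtain ⟨_, ⟨p, q, rfl⟩, _, rfl, rfl⟩ := Language.mem_mul.1 hy
    exact ⟨0 :: p, q, (rightForm_cons 0 p q).symm⟩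
  · obtain ⟨_, hy, rfl⟩ := mem_singleton_mul.1 hx
    obtain ⟨_, ⟨q, rfl⟩, _, rfl, rfl⟩ := Language.mem_mul.1 hy
    exact ⟨[], q, rfl⟩
  · obtain ⟨_, rfl, rfl⟩ := mem_singleton_mul.1 hx
    exact ⟨[], [], rfl⟩
  · obtain ⟨_, hy, rfl⟩ := mem_singleton_mul.1 hx
    obtain ⟨_, ⟨q, rfl⟩, rfl⟩ := mem_singleton_mul.1 hy
    exact ⟨0 :: q, rfl⟩
  · obtain ⟨_, hy, rfl⟩ := mem_singleton_mul.1 hx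
    obtain ⟨_, ⟨q, rfl⟩, rfl⟩ := mem_singleton_mul.1 hy
    exact ⟨1 :: q, rfl⟩
  · obtain ⟨_, rfl, rfl⟩ := mem_singleton_mul.1 hx
    exact ⟨[0], rfl⟩
  · obtain ⟨_, rfl, rfl⟩ := mem_singleton_mul.1 hx
    exact ⟨[1], rfl⟩
  · obtain ⟨_, hy, rfl⟩ := mem_singleton_mul.1 hx
    obtain ⟨_, ⟨q, rfl⟩, _, rfl, rfl⟩ := Language.mem_mul.1 hy
    exact ⟨0 :: q, (rightTail_cons 0 q).symm⟩
  · obtain ⟨_, hy, rfl⟩ := mem_singleton_mul.1 hx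
    obtain ⟨_, ⟨q, rfl⟩, _, rfl, rfl⟩ := Language.mem_mul.1 hy
    exact ⟨1 :: q, (rightTail_cons 1 q).symm⟩
  · obtain ⟨_, rfl, rfl⟩ := mem_singleton_mul.1 hx
    exact ⟨[0], rfl⟩
  · obtain ⟨_, rfl, rfl⟩ := mem_singleton_mul.1 hx
    exact ⟨[1], rfl⟩

/-- Derivability in `grammarG13`, on words over the concrete symbol type. -/
def Derives13 (u v : List (Symbol (Fin 3) NT13)) : Prop := grammarG13.Derives u v

theorem Derives13.append {n : NT13} {w : List (Symbol (Fin 3) NT13)}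
    (h : Derives13 [Symbol.nonterminal n] w) (a b) :
    Derives13 (a ++ [Symbol.nonterminal n] ++ b) (a ++ w ++ b) :=
  (ContextFreeGrammar.Derives.append_left h a).append_right b

theorem derives13_rule {n : NT13} {w : List (Symbol (Fin 3) NT13)}
    (h : ⟨n, w⟩ ∈ rules) :
    Derives13 [Symbol.nonterminal n] w :=
  derives_of_mem_rules (g := grammarG13) h

theorem Derives13.trans {u v w : List (Symbol (Fin 3) NT13)} (h : Derives13 u v)
    (h' : Derives13 v w) : Derives13 u w :=
  ContextFreeGrammar.Derives.trans h h'

theorem derives13_leftTail (b : Fin 2) (q : List (Fin 2)) :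
    Derives13 [Symbol.nonterminal NT13.Y] (leftTail (b :: q)) := by
  induction q generalizing b with
  | nil =>
    apply derives13_rule
    fin_cases b <;> simp [rules, grammarG13, leftTail, bit]
  | cons c q ih =>
    have h : Derives13 [Symbol.nonterminal NT13.Y]
        [bit b, Symbol.nonterminal NT13.D, Symbol.nonterminal NT13.Y] := by
      apply derives13_rule
      fin_cases b <;> simp [rules, grammarG13, bit]
    simpa [leftTail_cons] using h.trans ((ih c).append [bit b, Symbol.nonterminal NT13.D] [])

theorem derives13_rightTail (b : Fin 2) (q : List (Fin 2)) :
    Derives13 [Symbol.nonterminal NT13.Yb] (rightTail (b :: q)) := by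
  induction q generalizing b with
  | nil =>
    apply derives13_rule
    fin_cases b <;> simp [rules, grammarG13, rightTail, bit]
  | cons c q ih =>
    have h : Derives13 [Symbol.nonterminal NT13.Yb]
        [bit b, Symbol.nonterminal NT13.Yb, Symbol.nonterminal NT13.D] := by
      apply derives13_rule
      fin_cases b <;> simp [rules, grammarG13, bit]
    simpa [rightTail_cons] using h.trans ((ih c).append [bit b] [Symbol.nonterminal NT13.D])

theorem derives13_leftForm (p q : List (Fin 2)) :
    Derives13 [Symbol.nonterminal NT13.X] (leftForm p q) := by
  induction p with
  | nil =>
    cases q with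
    | nil =>
      apply derives13_rule
      simp [rules, grammarG13, leftForm, leftTail, bit]
    | cons b q =>
      have h : Derives13 [Symbol.nonterminal NT13.X]
          [bit 1, Symbol.nonterminal NT13.C, Symbol.nonterminal NT13.Y] := by
        apply derives13_rule
        simp [rules, grammarG13, bit]
      simpa [leftForm] using
        h.trans ((derives13_leftTail b q).append [bit 1, Symbol.nonterminal NT13.C] [])
  | cons b p ih =>
    have h : Derives13 [Symbol.nonterminal NT13.X]
        [bit b, mark b, Symbol.nonterminal NT13.X] := by
      apply derives13_rule
      fin_cases b <;> simp [rules, grammarG13, bit, mark]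
    simpa [leftForm_cons] using h.trans (ih.append [bit b, mark b] [])

theorem derives13_rightForm (p q : List (Fin 2)) :
    Derives13 [Symbol.nonterminal NT13.Xb] (rightForm p q) := by
  induction p with
  | nil =>
    cases q with
    | nil =>
      apply derives13_rule
      simp [rules, grammarG13, rightForm, rightTail, bit]
    | cons b q =>
      have h : Derives13 [Symbol.nonterminal NT13.Xb]
          [bit 0, Symbol.nonterminal NT13.Yb, Symbol.nonterminal NT13.C] := by
        apply derives13_rule
        simp [rules, grammarG13, bit]
      simpa [rightForm] using
        h.trans ((derives13_rightTail b q).append [bit 0] [Symbol.nonterminal NT13.C])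
  | cons b p ih =>
    have h : Derives13 [Symbol.nonterminal NT13.Xb]
        [bit b, Symbol.nonterminal NT13.Xb, mark b] := by
      apply derives13_rule
      fin_cases b <;> simp [rules, grammarG13, bit, mark]
    simpa [rightForm_cons] using h.trans (ih.append [bit b] [mark b])

theorem derives13_start (p q p' q' : List (Fin 2)) :
    Derives13 [Symbol.nonterminal NT13.S]
      (leftForm p q ++ Symbol.terminal 2 :: rightForm p' q') := by
  have h : Derives13 [Symbol.nonterminal NT13.S] [Symbol.nonterminal NT13.X,
      Symbol.terminal 2, Symbol.nonterminal NT13.Xb] := by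
    apply derives13_rule
    simp [rules, grammarG13]
  have hl := (derives13_leftForm p q).append [] [Symbol.terminal 2, Symbol.nonterminal NT13.Xb]
  have hr := (derives13_rightForm p' q').append (leftForm p q ++ [Symbol.terminal 2]) []
  simp only [List.nil_append, List.append_nil, List.append_assoc, List.singleton_append] at hl hr
  exact (h.trans hl).trans hr

/-- The alphabet `{A, B, C, D, #}`. -/
def alphabet : Set (Symbol (Fin 3) NT13) :=
  {Symbol.nonterminal NT13.A, Symbol.nonterminal NT13.B, Symbol.nonterminal NT13.C,
    Symbol.nonterminal NT13.D, Symbol.terminal 2}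

theorem projOn_append {α : Type*} (W : Set α) (x y : List α) :
    projOn W (x ++ y) = projOn W x ++ projOn W y :=
  List.filter_append ..

theorem projOn_eq_nil {α : Type*} {W : Set α} {x : List α} (h : ∀ a ∈ x, a ∉ W) :
    projOn W x = [] := by
  simpa [projOn] using h

theorem projOn_eq_self {α : Type*} {W : Set α} {x : List α} (h : ∀ a ∈ x, a ∈ W) :
    projOn W x = x := by
  simpa [projOn] using h

theorem projOn_cons_of_mem {α : Type*} {W : Set α} {a : α} (h : a ∈ W) (x : List α) :
    projOn W (a :: x) = a :: projOn W x := by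
  simp [projOn, h]

theorem projOn_cons_of_notMem {α : Type*} {W : Set α} {a : α} (h : a ∉ W) (x : List α) :
    projOn W (a :: x) = projOn W x := by
  simp [projOn, h]

theorem bit_notMem_alphabet (b : Fin 2) : bit b ∉ alphabet := by
  fin_cases b <;> simp [bit, alphabet]

theorem mark_mem_alphabet (b : Fin 2) : mark b ∈ alphabet := by
  fin_cases b <;> simp [mark, alphabet]

theorem singleton_mem_finalWords {n : NT13} (h : Symbol.nonterminal n ∈ alphabet) :
    [Symbol.nonterminal n] ∈ finalWords n := by
  cases n <;> first | exact Set.mem_singleton _ | simp [alphabet] at h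

theorem projOn_leftTail (q : List (Fin 2)) :
    projOn alphabet (leftTail q) = List.replicate q.length (Symbol.nonterminal NT13.D) := by
  induction q with
  | nil => rfl
  | cons b q ih =>
    rw [leftTail_cons, projOn_cons_of_notMem (bit_notMem_alphabet b),
      projOn_cons_of_mem (by simp [alphabet]), ih, List.length_cons, List.replicate_succ]

theorem projOn_leftForm (p q : List (Fin 2)) :
    projOn alphabet (leftForm p q) = p.map mark ++ Symbol.nonterminal NT13.C ::
      List.replicate q.length (Symbol.nonterminal NT13.D) := by
  induction p with
  | nil =>
    rw [leftForm, List.flatMap_nil, List.nil_append,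
      projOn_cons_of_notMem (bit_notMem_alphabet 1),
      projOn_cons_of_mem (by simp [alphabet]), projOn_leftTail, List.map_nil, List.nil_append]
  | cons b p ih =>
    rw [leftForm_cons, projOn_cons_of_notMem (bit_notMem_alphabet b),
      projOn_cons_of_mem (mark_mem_alphabet b), ih, List.map_cons, List.cons_append]

theorem projOn_rightForm (p q : List (Fin 2)) :
    projOn alphabet (rightForm p q) = (p.map mark ++ Symbol.nonterminal NT13.C ::
      List.replicate q.length (Symbol.nonterminal NT13.D)).reverse := by
  have hb (l : List (Fin 2)) : projOn alphabet (l.map bit) = [] :=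
    projOn_eq_nil (List.forall_mem_map.2 fun b _ => bit_notMem_alphabet b)
  rw [rightForm, projOn_append, hb, projOn_cons_of_notMem (bit_notMem_alphabet 0), rightTail,
    projOn_append, projOn_append, hb, projOn_eq_self, projOn_eq_self]
  · simp
  · rw [List.forall_mem_cons]
    refine ⟨by simp [alphabet], fun s hs => ?_⟩
    obtain ⟨b, -, rfl⟩ := List.mem_map.1 (List.mem_reverse.1 hs)
    exact mark_mem_alphabet b
  · simp +contextual [List.mem_replicate, alphabet]

theorem projT_start (p q p' q' : List (Fin 2)) :
    projT (leftForm p q ++ Symbol.terminal 2 :: rightForm p' q') =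
      (p ++ 1 :: q).map Fin.castSucc ++ (2 : Fin 3) :: (p' ++ 0 :: q').map Fin.castSucc := by
  have hb (l : List (Fin 2)) : projT (l.map bit) = l.map Fin.castSucc := by
    induction l with
    | nil => rfl
    | cons b l ih => simp_all [projT, bit]
  have ht (l : List (Fin 2)) : projT (leftTail l) = l.map Fin.castSucc := by
    induction l with
    | nil => rfl
    | cons b l ih => simp_all [projT, leftTail_cons, bit]
  have hl : projT (leftForm p q) = (p ++ 1 :: q).map Fin.castSucc := by
    induction p with
    | nil => simpa [projT, leftForm, bit] using ht q
    | cons b p ih => simp_all [projT, leftForm_cons, bit, mark]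
  have hm : projT (p'.map mark).reverse = [] := by
    simp [projT, mark]
  have hr : projT (rightForm p' q') = (p' ++ 0 :: q').map Fin.castSucc := by
    simp_all [projT, rightForm, rightTail, bit]
  simp_all [projT]

theorem symbols_start (p q p' q' : List (Fin 2)) :
    ∀ s ∈ leftForm p q ++ Symbol.terminal 2 :: rightForm p' q',
      s ∈ alphabet ∨ ∃ t, s = Symbol.terminal t := by
  intro s hs
  cases s with
  | terminal t => exact Or.inr ⟨t, rfl⟩
  | nonterminal n =>
    refine Or.inl ?_
    simp only [leftForm, leftTail, rightForm, rightTail, bit, List.mem_append, List.mem_flatMap,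
      List.mem_cons, List.mem_map, List.mem_reverse, List.mem_replicate, List.not_mem_nil] at hs
    simp only [reduceCtorEq, false_or, or_false, and_false, exists_false] at hs
    rcases hs with (⟨b, -, h⟩ | h | ⟨b, -, h⟩) | ⟨-, h⟩ | h | ⟨b, -, h⟩
    · exact h ▸ mark_mem_alphabet b
    · simp [h, alphabet]
    · simp [h, alphabet]
    · simp [h, alphabet]
    · simp [h, alphabet]
    · exact h ▸ mark_mem_alphabet b

theorem mark_injective : Function.Injective mark := by
  intro a b h
  fin_cases a <;> fin_cases b <;> simp_all [mark]

theorem C_notMem_map_mark (p : List (Fin 2)) : Symbol.nonterminal NT13.C ∉ p.map mark := by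
  simp only [List.mem_map, not_exists, not_and]
  intro b _
  fin_cases b <;> simp [mark]

theorem eq_of_marks_eq {p q p' q' : List (Fin 2)}
    (h : p.map mark ++ Symbol.nonterminal NT13.C ::
        List.replicate q.length (Symbol.nonterminal NT13.D) =
      p'.map mark ++ Symbol.nonterminal NT13.C ::
        List.replicate q'.length (Symbol.nonterminal NT13.D)) :
    p = p' ∧ q.length = q'.length := by
  rw [List.append_cons_inj_of_notMem (C_notMem_map_mark p)
    (by simp [List.mem_replicate])] at h
  exact ⟨mark_injective.list_map h.1, by simpa using congrArg List.length h.2.2⟩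

theorem binVal_cons (b : Fin 2) (u : List (Fin 2)) :
    binVal (b :: u) = b.val * 2 ^ u.length + binVal u := by
  have h (n : ℕ) : u.foldl (fun n b => 2 * n + b.val) n = n * 2 ^ u.length + binVal u := by
    unfold binVal
    induction u generalizing n with
    | nil => simp
    | cons c u ih =>
      rw [List.foldl_cons, ih, List.foldl_cons, ih (2 * 0 + c.val), List.length_cons]
      ring
  rw [binVal, List.foldl_cons, h]
  simp

theorem binVal_lt (u : List (Fin 2)) : binVal u < 2 ^ u.length := by
  induction u with
  | nil => simp [binVal]
  | cons b u ih =>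
    rw [binVal_cons, List.length_cons, pow_succ]
    have := Nat.mul_le_mul_right (2 ^ u.length) (Nat.le_of_lt_succ b.isLt)
    omega

/-- For binary strings of equal length, the comparison of values is decided at the first
position where they differ. -/
theorem binVal_lt_binVal_iff {u v : List (Fin 2)} (h : u.length = v.length) :
    binVal v < binVal u ↔
      ∃ p q q', q.length = q'.length ∧ u = p ++ 1 :: q ∧ v = p ++ 0 :: q' := by
  constructor
  · induction u generalizing v with
    | nil => simp [binVal]
    | cons a u ih =>
      cases v with
      | nil => simp at h
      | cons b v =>
        have hl : u.length = v.length := by simpa using h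
        intro hlt
        rw [binVal_cons, binVal_cons, hl] at hlt
        have hu := hl ▸ binVal_lt u
        by_cases hab : a = b
        · subst hab
          obtain ⟨p, q, q', hq, rfl, rfl⟩ := ih hl (by omega)
          exact ⟨a :: p, q, q', hq, rfl, rfl⟩
        · fin_cases a <;> fin_cases b <;> simp at hab hlt
          · omega
          · exact ⟨[], u, v, hl, rfl, rfl⟩
  · rintro ⟨p, q, q', hq, rfl, rfl⟩
    clear h
    induction p with
    | nil =>
      have := binVal_lt q'
      simp only [List.nil_append, binVal_cons, hq]
      simp
      omega
    | cons b p ih =>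
      simpa [binVal_cons, hq] using ih

end GrammarG13

/-- With `W = {A, B, C, D, #}` and `F = {w#w^R : w ∈ {A,B,C,D}⁺}`,
`L(G,F) = {u#v : u, v ∈ {0,1}⁺, |u| = |v|, i(u) > i(v)}`. -/
theorem grammarG13_finalized :
    finalizedLanguage grammarG13
      ({Symbol.nonterminal NT13.A, Symbol.nonterminal NT13.B, Symbol.nonterminal NT13.C,
        Symbol.nonterminal NT13.D, Symbol.terminal 2} : Set (Symbol (Fin 3) NT13))
      { x | ∃ w : List (Symbol (Fin 3) NT13), w ≠ [] ∧
          (∀ s ∈ w, s = Symbol.nonterminal NT13.A ∨ s = Symbol.nonterminal NT13.B ∨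
            s = Symbol.nonterminal NT13.C ∨ s = Symbol.nonterminal NT13.D) ∧
          x = w ++ Symbol.terminal 2 :: w.reverse } =
    { x | ∃ u v : List (Fin 2), u ≠ [] ∧ v ≠ [] ∧ u.length = v.length ∧
        binVal v < binVal u ∧
        x = u.map Fin.castSucc ++ (2 : Fin 3) :: v.map Fin.castSucc } := by
  open GrammarG13 in
  ext x
  constructor
  · rintro ⟨y, hy, ⟨w, -, hw, hproj⟩, hsym, rfl⟩
    have hself := ContextFreeGrammar.mem_prod_symbolLanguage_self (L := finalWords) (y := y)
      fun n hn => singleton_mem_finalWords ((hsym _ hn).resolve_right (by simp))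
    have hmem := hy.prod_symbolLanguage_le prod_symbolLanguage_finalWords_le hself
    rw [List.map_singleton, List.prod_singleton] at hmem
    obtain ⟨p, q, p', q', rfl⟩ := hmem
    change projOn alphabet _ = _ at hproj
    rw [projOn_append, projOn_cons_of_mem (by simp [alphabet]), projOn_leftForm,
      projOn_rightForm, eq_comm, List.append_cons_inj_of_notMem
        (fun h => by simpa using hw _ h)
        (fun h => by simpa using hw _ (List.mem_reverse.1 h))] at hproj
    obtain ⟨rfl, -, hrev⟩ := hproj
    obtain ⟨rfl, hq⟩ := eq_of_marks_eq (List.reverse_injective hrev)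
    have hlen : (p ++ 1 :: q).length = (p ++ 0 :: q').length := by simp [hq]
    exact ⟨p ++ 1 :: q, p ++ 0 :: q', by simp, by simp, hlen,
      (binVal_lt_binVal_iff hlen).2 ⟨p, q, q', hq, rfl, rfl⟩, projT_start p q p q'⟩
  · rintro ⟨u, v, -, -, hlen, hlt, rfl⟩
    obtain ⟨p, q, q', hq, rfl, rfl⟩ := (binVal_lt_binVal_iff hlen).1 hlt
    refine ⟨_, derives13_start p q p q', ⟨p.map mark ++ Symbol.nonterminal NT13.C ::
      List.replicate q.length (Symbol.nonterminal NT13.D), by simp, ?_, ?_⟩,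
      symbols_start p q p q', (projT_start p q p q').symm⟩
    · intro s hs
      simp only [List.mem_append, List.mem_map, List.mem_cons, List.mem_replicate] at hs
      rcases hs with ⟨b, -, rfl⟩ | rfl | ⟨-, rfl⟩
      · fin_cases b <;> simp [mark]
      · simp
      · simp
    · change projOn alphabet _ = _
      rw [projOn_append, projOn_cons_of_mem (by simp [alphabet]), projOn_leftForm,
        projOn_rightForm, hq]
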